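/- arXiv:2006.04521 — 3 statements merged into one kernel-verified Lean document; each statement's English description precedes it below -/
import Mathlib

section
/- Let R be a prime ring and I a nonzero (two-sided) ideal of R. Suppose F : R → R is a multiplicative (generalized)-derivation associated with a multiplicative derivation δ of R such that F acts as an anti-homomorphism on I, i.e., F(xy) = F(y)F(x) for all x, y ∈ I. Then δ = 0, and either F = 0 or F(x) = x for all x ∈ R (and in the latter case R is commutative). -/
section PrimeIdeal

variable {R : Type*} [Ring R]

/-- In a prime ring, `a I b = 0` for a nonzero ideal `I` forces `a = 0` or `b = 0`. -/
theorem eq_zero_or_eq_zero_of_forall_mem_mul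
    (hprime : ∀ a b : R, (∀ r : R, a * r * b = 0) → a = 0 ∨ b = 0)
    {I : TwoSidedIdeal R} (hI : ∃ x : R, x ∈ I ∧ x ≠ 0) {a b : R}
    (h : ∀ y ∈ I, a * y * b = 0) : a = 0 ∨ b = 0 := by
  obtain ⟨x, hx, hx0⟩ := hI
  by_cases ha : a = 0
  · exact Or.inl ha
  refine Or.inr ((hprime x b fun s => ?_).resolve_left hx0)
  refine (hprime a (x * s * b) fun r => ?_).resolve_left ha
  have := h (r * (x * s)) (I.mul_mem_left _ _ (I.mul_mem_right _ _ hx))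
  simpa only [mul_assoc] using this

/-- In a prime ring, an element annihilating a nonzero ideal from the left is zero. -/
theorem eq_zero_of_forall_mem_mul_eq_zero
    (hprime : ∀ a b : R, (∀ r : R, a * r * b = 0) → a = 0 ∨ b = 0)
    {I : TwoSidedIdeal R} (hI : ∃ x : R, x ∈ I ∧ x ≠ 0) {a : R}
    (h : ∀ y ∈ I, a * y = 0) : a = 0 := by
  obtain ⟨x, -, hx0⟩ := id hI
  exact (eq_zero_or_eq_zero_of_forall_mem_mul hprime hI (b := x)
    fun y hy => by rw [h y hy, zero_mul]).resolve_right hx0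

/-- A prime ring with a nonzero central ideal is commutative. -/
theorem mul_comm_of_forall_mem_commute
    (hprime : ∀ a b : R, (∀ r : R, a * r * b = 0) → a = 0 ∨ b = 0)
    {I : TwoSidedIdeal R} (hI : ∃ x : R, x ∈ I ∧ x ≠ 0)
    (h : ∀ x ∈ I, ∀ w : R, x * w = w * x) (u v : R) : u * v = v * u := by
  refine sub_eq_zero.1 (eq_zero_of_forall_mem_mul_eq_zero hprime hI fun x hx => ?_)
  have h1 := h (u * x) (I.mul_mem_left _ _ hx) v
  have h2 := h x hx v
  rw [sub_mul, sub_eq_zero, mul_assoc v, ← h1, mul_assoc, mul_assoc, h2]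

/-- Nonzero central elements of a prime ring are not left zero divisors. -/
theorem eq_zero_or_eq_zero_of_central_mul_eq_zero
    (hprime : ∀ a b : R, (∀ r : R, a * r * b = 0) → a = 0 ∨ b = 0)
    {c b : R} (hc : ∀ w : R, c * w = w * c) (h : c * b = 0) : c = 0 ∨ b = 0 :=
  hprime c b fun r => by rw [hc, mul_assoc, h, mul_zero]

/-- A multiplicative derivation of a prime ring vanishing on a nonzero ideal is zero. -/
theorem multiplicative_derivation_eq_zero
    (hprime : ∀ a b : R, (∀ r : R, a * r * b = 0) → a = 0 ∨ b = 0)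
    {I : TwoSidedIdeal R} (hI : ∃ x : R, x ∈ I ∧ x ≠ 0) {d : R → R}
    (hd : ∀ x y : R, d (x * y) = d x * y + x * d y)
    (h : ∀ x ∈ I, d x = 0) (r : R) : d r = 0 := by
  refine eq_zero_of_forall_mem_mul_eq_zero hprime hI fun y hy => ?_
  have := hd r y
  rwa [h y hy, h _ (I.mul_mem_left _ _ hy), mul_zero, add_zero, eq_comm] at this

/-- Anti-homomorphism identity, compared on the two groupings of `x * y * z`. -/
theorem antihom_identity {I : TwoSidedIdeal R} {F δ : R → R}
    (hF : ∀ x y : R, F (x * y) = F x * y + x * δ y)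
    (hanti : ∀ x ∈ I, ∀ y ∈ I, F (x * y) = F y * F x)
    {x y : R} (hx : x ∈ I) (hy : y ∈ I) (z : R) :
    F y * (z * F x - F x * z) + y * δ z * F x = x * y * δ z := by
  have h1 := hanti x hx (y * z) (I.mul_mem_right _ _ hy)
  rw [← mul_assoc, hF (x * y) z, hanti x hx y hy, hF y z, add_mul] at h1
  rw [← sub_eq_zero] at h1 ⊢
  rw [← neg_eq_zero, ← h1]
  noncomm_ring

/-- The associated multiplicative derivation vanishes. -/
theorem antihom_derivation_eq_zero
    (hprime : ∀ a b : R, (∀ r : R, a * r * b = 0) → a = 0 ∨ b = 0)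
    {I : TwoSidedIdeal R} (hI : ∃ x : R, x ∈ I ∧ x ≠ 0) {F δ : R → R}
    (hδ : ∀ x y : R, δ (x * y) = δ x * y + x * δ y)
    (hF : ∀ x y : R, F (x * y) = F x * y + x * δ y)
    (hanti : ∀ x ∈ I, ∀ y ∈ I, F (x * y) = F y * F x) : δ = 0 := by
  by_contra hne
  obtain ⟨z₀, hz₀⟩ : ∃ z, δ z ≠ 0 := Function.ne_iff.1 hne
  have hF1 (w : R) : F w = F 1 * w + δ w := by simpa using hF 1 w
  obtain ⟨d, hd⟩ : ∃ d : R → R, ∀ w, d w = F w - w * F 1 := ⟨_, fun _ => rfl⟩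
  have d_mul (u v : R) : d (u * v) = d u * v + u * d v := by
    rw [hd, hd, hd, hF, hF1 v]
    noncomm_ring
  have key : ∀ x ∈ I, ∀ y ∈ I, ∀ w z,
      d w * y * (z * F x - F x * z) = (x * w - w * x) * y * δ z := by
    intro x hx y hy w z
    have h1 := antihom_identity hF hanti hx (I.mul_mem_left w y hy) z
    have h2 := congrArg (w * ·) (antihom_identity hF hanti hx hy z)
    have h3 : d w * y = F (w * y) - w * F y := by
      rw [hd, hF, hF1 y]
      noncomm_ring
    have h4 := congrArg₂ (· - ·) h1 h2
    rw [h3]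
    rw [← sub_eq_zero] at h4 ⊢
    rw [← h4]
    noncomm_ring
  have central_of_F {x : R} (hx : x ∈ I) (h : ∀ z, z * F x - F x * z = 0) (w : R) :
      x * w = w * x := by
    refine sub_eq_zero.1 ((eq_zero_or_eq_zero_of_forall_mem_mul hprime hI
      (b := δ z₀) fun y hy => ?_).resolve_right hz₀)
    rw [← key x hx y hy w z₀, h, mul_zero]
  have d_or {x : R} (hx : x ∈ I) : d x = 0 ∨ ∀ w, x * w = w * x := by
    by_cases h0 : d x = 0
    · exact Or.inl h0
    refine Or.inr (central_of_F hx fun z => ?_)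
    refine (eq_zero_or_eq_zero_of_forall_mem_mul hprime hI fun y hy => ?_).resolve_left h0
    rw [key x hx y hy x z, sub_self, zero_mul, zero_mul]
  have comm : ∀ u v : R, u * v = v * u := by
    refine mul_comm_of_forall_mem_commute hprime hI ?_
    by_contra! hnc
    obtain ⟨x₀, hx₀, w₀, hw₀⟩ := hnc
    have nc_mem : d x₀ = 0 := (d_or hx₀).resolve_right fun h => hw₀ (h w₀)
    have hx₀0 : x₀ ≠ 0 := by
      rintro rfl
      simp at hw₀
    have d_zero : ∀ x ∈ I, d x = 0 := by
      intro x hx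
      rcases d_or hx with h | hc
      · exact h
      by_cases hx0 : x = 0
      · rw [hx0]
        simpa using d_mul 0 0
      have dx_central (w : R) : d x * w = w * d x := by
        have h := d_mul x w
        rw [hc w, d_mul w x, hc (d w), add_comm] at h
        exact (add_right_cancel h).symm
      have hxx₀ : d (x * x₀) = 0 := by
        refine (d_or (I.mul_mem_left x x₀ hx₀)).resolve_right fun h => hw₀ ?_
        refine sub_eq_zero.1 ((eq_zero_or_eq_zero_of_central_mul_eq_zero hprime hc
          ?_).resolve_left hx0)
        rw [mul_sub, ← mul_assoc, h w₀, ← mul_assoc, ← mul_assoc, hc w₀, sub_self]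
      rw [d_mul, nc_mem, mul_zero, add_zero] at hxx₀
      exact (eq_zero_or_eq_zero_of_central_mul_eq_zero hprime dx_central hxx₀).resolve_right
        hx₀0
    have d_all := multiplicative_derivation_eq_zero hprime hI d_mul d_zero
    refine hw₀ (sub_eq_zero.1 ((eq_zero_or_eq_zero_of_forall_mem_mul hprime hI
      (b := δ z₀) fun y hy => ?_).resolve_right hz₀))
    rw [← key x₀ hx₀ y hy w₀ z₀, d_all, zero_mul, zero_mul]
  have F_id : ∀ x ∈ I, F x = x := by
    intro x hx
    have h : ∀ y ∈ I, (F x - x) * y * δ z₀ = 0 := by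
      intro y hy
      have h1 := antihom_identity hF hanti hx hy z₀
      rw [comm z₀, sub_self, mul_zero, zero_add, comm _ (F x), ← mul_assoc] at h1
      rw [sub_mul, sub_mul, h1, sub_self]
    exact sub_eq_zero.1
      ((eq_zero_or_eq_zero_of_forall_mem_mul hprime hI h).resolve_right hz₀)
  refine hz₀ (multiplicative_derivation_eq_zero hprime hI hδ (fun y hy => ?_) z₀)
  refine eq_zero_of_forall_mem_mul_eq_zero hprime hI fun x hx => ?_
  have h := hF x y
  rw [F_id _ (I.mul_mem_left x y hy), F_id x hx, left_eq_add] at h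
  rw [comm, h]

end PrimeIdeal

/-- Let `R` be a prime ring and `I` a nonzero two-sided ideal.  If `F` is a
multiplicative (generalized)-derivation associated with `δ` acting as an
anti-homomorphism on `I`, then `δ = 0`, and either `F = 0` or `F(x) = x` for all
`x ∈ R` (in which case `R` is commutative). -/
theorem stmt_10 {R : Type*} [Ring R]
    (hprime : ∀ a b : R, (∀ r : R, a * r * b = 0) → a = 0 ∨ b = 0)
    (I : TwoSidedIdeal R) (hI : ∃ x : R, x ∈ I ∧ x ≠ 0)
    (F δ : R → R)
    (hδ : ∀ x y : R, δ (x * y) = δ x * y + x * δ y)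
    (hF : ∀ x y : R, F (x * y) = F x * y + x * δ y)
    (hanti : ∀ x ∈ I, ∀ y ∈ I, F (x * y) = F y * F x) :
    δ = 0 ∧ (F = 0 ∨ ((∀ x : R, F x = x) ∧ ∀ a b : R, a * b = b * a)) := by
  obtain rfl := antihom_derivation_eq_zero hprime hI hδ hF hanti
  refine ⟨rfl, ?_⟩
  have hF1 (w : R) : F w = F 1 * w := by simpa using hF 1 w
  by_cases ha : F 1 = 0
  · refine Or.inl (funext fun w => ?_)
    rw [hF1, ha, zero_mul, Pi.zero_apply]
  have F_central : ∀ x ∈ I, ∀ z, F x * z = z * F x := by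
    intro x hx z
    refine (sub_eq_zero.1 ((eq_zero_or_eq_zero_of_forall_mem_mul hprime hI
      fun y hy => ?_).resolve_left ha)).symm
    simpa [hF1 y] using antihom_identity hF hanti hx hy z
  obtain ⟨x, hx, hFx⟩ : ∃ x ∈ I, F x ≠ 0 := by
    by_contra! h
    exact ha (eq_zero_of_forall_mem_mul_eq_zero hprime hI fun y hy => by
      rw [← hF1, h y hy])
  have F_id : ∀ y ∈ I, F y = y := by
    intro y hy
    refine sub_eq_zero.1 ((eq_zero_or_eq_zero_of_central_mul_eq_zero hprime
      (F_central x hx) ?_).resolve_left hFx)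
    have h := hF x y
    rw [hanti x hx y hy, Pi.zero_apply, mul_zero, add_zero] at h
    rw [mul_sub, F_central x hx, h, sub_self]
  have hone : F 1 = 1 := by
    refine sub_eq_zero.1 (eq_zero_of_forall_mem_mul_eq_zero hprime hI fun y hy => ?_)
    rw [sub_mul, ← hF1, F_id y hy, one_mul, sub_self]
  refine Or.inr ⟨fun w => by rw [hF1, hone, one_mul],
    mul_comm_of_forall_mem_commute hprime hI fun y hy w => ?_⟩
  simpa [F_id y hy] using F_central y hy w
end

section
/- Let R be a prime ring, I a nonzero (two-sided) ideal of R, and n ≥ 2 a fixed integer. Suppose F : R → R is a two-sided multiplicative (generalized)-derivation associated with a multiplicative derivation δ of R such that F acts as an n-antihomomorphism on I. Then δ = 0, and either F = 0, or R is commutative, F(x)y = xF(y) for all x, y ∈ R, and the (n−1)-fold iterate of F is the identity map on R. -/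
/-- The elements of `R` that are products of exactly `m` elements of `I`. -/
def productsOfLength {R : Type*} [Ring R] (I : TwoSidedIdeal R) (m : ℕ) : Set R :=
  {w | ∃ l : List R, l.length = m ∧ (∀ x ∈ l, x ∈ I) ∧ l.prod = w}

theorem productsOfLength_mul_right {R : Type*} [Ring R] {I : TwoSidedIdeal R} {m : ℕ}
    (hm : m ≠ 0) {w : R} (hw : w ∈ productsOfLength I m) (r : R) :
    w * r ∈ productsOfLength I m := by
  obtain ⟨l, hl, hlI, rfl⟩ := hw
  rcases List.eq_nil_or_concat' l with rfl | ⟨l', z, rfl⟩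
  · exact absurd hl.symm hm
  · refine ⟨l' ++ [z * r], by simpa using hl, fun x hx => ?_, by simp [mul_assoc]⟩
    rcases List.mem_append.1 hx with h | h
    · exact hlI x (by simp [h])
    · rw [List.mem_singleton.1 h]
      exact I.mul_mem_right _ _ (hlI z (by simp))

theorem exists_ne_zero_mem_productsOfLength {R : Type*} [Ring R]
    (hprime : ∀ a b : R, (∀ r : R, a * r * b = 0) → a = 0 ∨ b = 0)
    {I : TwoSidedIdeal R} {u : R} (huI : u ∈ I) (hu : u ≠ 0) (m : ℕ) :
    ∃ w ∈ productsOfLength I m, w ≠ 0 := by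
  induction m with
  | zero =>
    refine ⟨1, ⟨[], rfl, by simp, rfl⟩, fun h => hu ?_⟩
    rw [← mul_one u, h, mul_zero]
  | succ k ih =>
    obtain ⟨w, ⟨l, hl, hlI, rfl⟩, hw⟩ := ih
    obtain ⟨r, hr⟩ : ∃ r, l.prod * r * u ≠ 0 := by
      by_contra! h
      exact (hprime _ _ h).elim hw hu
    refine ⟨l.prod * r * u, ⟨l ++ [r * u], by simp [hl], fun x hx => ?_, by simp [mul_assoc]⟩, hr⟩
    rcases List.mem_append.1 hx with h | h
    · exact hlI x h
    · rw [List.mem_singleton.1 h]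
      exact I.mul_mem_left _ _ huI

theorem eq_zero_or_eq_zero_of_forall_mem_ideal {R : Type*} [Ring R]
    (hprime : ∀ a b : R, (∀ r : R, a * r * b = 0) → a = 0 ∨ b = 0)
    {I : TwoSidedIdeal R} (hI : ∃ x : R, x ∈ I ∧ x ≠ 0) (a b : R)
    (h : ∀ x ∈ I, a * x * b = 0) : a = 0 ∨ b = 0 := by
  obtain ⟨u, huI, hu⟩ := hI
  by_contra! hab
  have hub : ∀ s, u * s * b = 0 := fun s =>
    (hprime a (u * s * b) fun r => by
      simpa only [mul_assoc] using
        h (r * (u * s)) (I.mul_mem_left _ _ (I.mul_mem_right _ _ huI))).resolve_left hab.1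
  exact (hprime u b hub).elim hu hab.2

theorem eq_zero_of_central_mul_eq_zero {R : Type*} [Ring R]
    (hprime : ∀ a b : R, (∀ r : R, a * r * b = 0) → a = 0 ∨ b = 0)
    {c b : R} (hc : ∀ y, c * y = y * c) (hc0 : c ≠ 0) (h : c * b = 0) : b = 0 :=
  (hprime c b fun r => by rw [hc r, mul_assoc, h, mul_zero]).resolve_left hc0

theorem prod_map_reverse_of_commute {R : Type*} [Ring R] (hcomm : ∀ a b : R, a * b = b * a)
    {F : R → R} {c : R} (hF : ∀ x, F x = c * x) (l : List R) :
    (l.reverse.map F).prod = c ^ l.length * l.prod := by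
  induction l with
  | nil => simp
  | cons a l ih =>
    simp only [List.reverse_cons, List.map_append, List.map_cons, List.map_nil, List.prod_append,
      List.prod_cons, List.prod_nil, List.length_cons, mul_one, ih, hF, pow_succ]
    rw [hcomm _ (c * a), hcomm (c ^ l.length) c]
    simp only [mul_assoc]
    rw [← mul_assoc a, hcomm a (c ^ l.length), mul_assoc]

theorem iterate_eq_pow_mul {R : Type*} [Ring R] {F : R → R} {c : R}
    (hF : ∀ x, F x = c * x) (k : ℕ) (x : R) : F^[k] x = c ^ k * x := by
  induction k with
  | zero => simp
  | succ k ih => rw [Function.iterate_succ_apply', ih, hF, pow_succ', mul_assoc]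

/-- If right multiples of a nonzero element are all central, the ring is commutative. -/
theorem commute_of_forall_mul_central {R : Type*} [Ring R]
    (hprime : ∀ a b : R, (∀ r : R, a * r * b = 0) → a = 0 ∨ b = 0)
    {w : R} (hw0 : w ≠ 0) (hw : ∀ r y, w * r * y = y * (w * r)) (a b : R) : a * b = b * a := by
  have hw1 : ∀ y, w * y = y * w := by simpa using hw 1
  refine sub_eq_zero.1 (eq_zero_of_central_mul_eq_zero hprime hw1 hw0 ?_)
  rw [mul_sub, ← mul_assoc, hw, ← mul_assoc, ← mul_assoc, hw1 b, sub_self]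

/-- A multiplicative derivation killing a nonzero element and all its right multiples vanishes. -/
theorem derivation_eq_zero_of_forall_mul {R : Type*} [Ring R]
    (hprime : ∀ a b : R, (∀ r : R, a * r * b = 0) → a = 0 ∨ b = 0) {δ : R → R}
    (hδ : ∀ x y : R, δ (x * y) = δ x * y + x * δ y) {w : R} (hw0 : w ≠ 0)
    (hw : ∀ r, δ (w * r) = 0) : δ = 0 := by
  funext y
  refine (hprime w (δ y) fun r => ?_).resolve_left hw0
  simpa [hw, mul_assoc] using (hδ (w * r) y).symm.trans (by rw [mul_assoc, hw])

/-- A prime ring with a multiplicative derivation `δ` is commutative if some nonzero `w` has each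
right multiple either central or killed by `δ`, while `δ w ≠ 0`. -/
theorem commute_of_derivation_eq_zero_or_central {R : Type*} [Ring R]
    (hprime : ∀ a b : R, (∀ r : R, a * r * b = 0) → a = 0 ∨ b = 0) {δ : R → R}
    (hδ : ∀ x y : R, δ (x * y) = δ x * y + x * δ y) {w : R} (hδw : δ w ≠ 0) (hw0 : w ≠ 0)
    (hw : ∀ r, δ (w * r) = 0 ∨ ∀ y, w * r * y = y * (w * r)) (a b : R) : a * b = b * a := by
  have hwc : ∀ y, w * y = y * w := by simpa [hδw] using hw 1
  have hδwc : ∀ y, δ w * y = y * δ w := fun y => by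
    have h := congrArg δ (hwc y)
    rw [hδ, hδ, hwc (δ y), add_comm] at h
    exact add_left_cancel h
  have cancel : ∀ {r y}, w * (r * y) = w * (y * r) → r * y = y * r := fun {r y} h =>
    sub_eq_zero.1 (eq_zero_of_central_mul_eq_zero hprime hwc hw0 (by rw [mul_sub, h, sub_self]))
  by_contra hab
  have h1 : δ (w * a) = 0 := (hw a).resolve_right fun h => hab <| cancel <| by
    rw [← mul_assoc, h, ← mul_assoc, ← mul_assoc, hwc b]
  have h2 : δ (w * (w * a)) = 0 := (hw (w * a)).resolve_right fun h => hab <| cancel <| by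
    have := eq_zero_of_central_mul_eq_zero hprime hwc hw0
      (b := w * (a * b) - w * (b * a)) (by
        have h' := h b
        rw [← mul_assoc b, ← hwc b, mul_assoc, mul_assoc, mul_assoc, ← mul_assoc b,
          ← hwc b, mul_assoc] at h'
        rw [mul_sub, h', sub_self])
    exact sub_eq_zero.1 this
  rw [hδ, h1, mul_zero, add_zero] at h2
  have ha : a = 0 := eq_zero_of_central_mul_eq_zero hprime hwc hw0
    (eq_zero_of_central_mul_eq_zero hprime hδwc hδw h2)
  exact hab (by simp [ha])

/-- The exchange identity behind the `n`-antihomomorphism condition. -/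
theorem antihom_exchange {R : Type*} [Ring R] {I : TwoSidedIdeal R} {F δ : R → R}
    (hF : ∀ x y : R, F (x * y) = F x * y + x * δ y) {w P : R}
    (h : ∀ x ∈ I, F (w * x) = F x * P) {x : R} (hx : x ∈ I) (y : R) :
    F x * (P * y - y * P) + w * x * δ y = x * δ y * P := by
  have h1 := h (x * y) (I.mul_mem_right _ _ hx)
  rw [← mul_assoc, hF, h x hx, hF x y] at h1
  calc F x * (P * y - y * P) + w * x * δ y
      = (F x * P * y + w * x * δ y) - F x * y * P := by noncomm_ring
    _ = x * δ y * P := by rw [h1]; noncomm_ring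

theorem antihom_derivation_add {R : Type*} [Ring R] {I : TwoSidedIdeal R} {F δ : R → R}
    (hF : ∀ x y : R, F (x * y) = F x * y + x * δ y)
    (hF' : ∀ x y : R, F (x * y) = δ x * y + x * F y) {w P : R}
    (h : ∀ x ∈ I, F (w * x) = F x * P) {x : R} (hx : x ∈ I) (r y : R) :
    δ r * x * (P * y - y * P) + (w * r - r * w) * x * δ y = 0 := by
  have h1 := antihom_exchange hF h hx y
  have h2 := antihom_exchange hF h (I.mul_mem_left r _ hx) y
  rw [hF' r x] at h2
  calc δ r * x * (P * y - y * P) + (w * r - r * w) * x * δ y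
      = ((δ r * x + r * F x) * (P * y - y * P) + w * (r * x) * δ y)
        - r * (F x * (P * y - y * P) + w * x * δ y) := by noncomm_ring
    _ = 0 := by rw [h1, h2]; noncomm_ring

theorem derivation_eq_zero_or_central_of_antihom {R : Type*} [Ring R]
    (hprime : ∀ a b : R, (∀ r : R, a * r * b = 0) → a = 0 ∨ b = 0)
    {I : TwoSidedIdeal R} (hI : ∃ x : R, x ∈ I ∧ x ≠ 0) {F δ : R → R} (hδ0 : δ ≠ 0)
    (hF : ∀ x y : R, F (x * y) = F x * y + x * δ y)
    (hF' : ∀ x y : R, F (x * y) = δ x * y + x * F y) {w P : R}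
    (h : ∀ x ∈ I, F (w * x) = F x * P) : δ w = 0 ∨ ∀ y, w * y = y * w := by
  refine or_iff_not_imp_left.2 fun hw r => ?_
  have hP : ∀ y, P * y - y * P = 0 := fun y =>
    (eq_zero_or_eq_zero_of_forall_mem_ideal hprime hI _ _ fun x hx => by
      simpa using antihom_derivation_add hF hF' h hx w y).resolve_left hw
  obtain ⟨y, hy⟩ := Function.ne_iff.1 hδ0
  exact sub_eq_zero.1 <|
    (eq_zero_or_eq_zero_of_forall_mem_ideal hprime hI _ _ fun x hx => by
      simpa [hP] using antihom_derivation_add hF hF' h hx r y).resolve_right hy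

theorem derivation_eq_zero_of_antihom_of_commute {R : Type*} [Ring R]
    (hcomm : ∀ a b : R, a * b = b * a)
    (hprime : ∀ a b : R, (∀ r : R, a * r * b = 0) → a = 0 ∨ b = 0)
    {I : TwoSidedIdeal R} (hI : ∃ x : R, x ∈ I ∧ x ≠ 0) {F δ : R → R} (hδ0 : δ ≠ 0)
    (hF : ∀ x y : R, F (x * y) = F x * y + x * δ y) {w P : R}
    (h : ∀ x ∈ I, F (w * x) = F x * P) : δ w = 0 := by
  obtain ⟨u, huI, hu⟩ := hI
  obtain ⟨y, hy⟩ := Function.ne_iff.1 hδ0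
  have hwP : w = P := by
    have h1 := antihom_exchange hF h huI y
    rw [hcomm y P, sub_self, mul_zero, zero_add, hcomm _ P, mul_assoc, ← sub_eq_zero,
      ← sub_mul, hcomm] at h1
    have h2 := eq_zero_of_central_mul_eq_zero hprime (hcomm u) hu ((mul_assoc _ _ _).symm.trans h1)
    exact sub_eq_zero.1 (eq_zero_of_central_mul_eq_zero hprime (hcomm _) hy h2)
  have h3 := h u huI
  rw [hcomm w u, hF, ← hwP, add_eq_left] at h3
  exact eq_zero_of_central_mul_eq_zero hprime (hcomm u) hu h3

theorem central_of_antihom_of_eq_mul {R : Type*} [Ring R]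
    (hprime : ∀ a b : R, (∀ r : R, a * r * b = 0) → a = 0 ∨ b = 0)
    {I : TwoSidedIdeal R} (hI : ∃ x : R, x ∈ I ∧ x ≠ 0) {F : R → R} {c : R}
    (hc : ∀ y, c * y = y * c) (hc0 : c ≠ 0) (hFc : ∀ x, F x = c * x) {w P : R}
    (h : ∀ x ∈ I, F (w * x) = F x * P) : w = P ∧ ∀ y, w * y = y * w := by
  have hP : ∀ y, P * y - y * P = 0 := fun y =>
    (eq_zero_or_eq_zero_of_forall_mem_ideal hprime hI _ _ fun x hx => by
      have h1 := antihom_exchange (F := F) (δ := 0) (fun a b => by simp [hFc, mul_assoc]) h hx y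
      simpa [hFc] using h1).resolve_left hc0
  have hwP : w = P := by
    refine sub_eq_zero.1 <| (eq_zero_or_eq_zero_of_forall_mem_ideal hprime hI _ 1
      fun x hx => ?_).resolve_right ?_
    · have h1 := h x hx
      rw [hFc, hFc, mul_assoc, ← sub_eq_zero, ← mul_sub] at h1
      rw [mul_one, sub_mul, sub_eq_zero.1 (hP x)]
      exact eq_zero_of_central_mul_eq_zero hprime hc hc0 h1
    · intro h10
      exact hc0 (by rw [← mul_one c, h10, mul_zero])
  exact ⟨hwP, fun y => sub_eq_zero.1 (hwP ▸ hP y)⟩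

/-- Let `R` be a prime ring, `I` a nonzero two-sided ideal, `n ≥ 2`.  If `F` is a
two-sided multiplicative (generalized)-derivation associated with `δ` acting as an
`n`-antihomomorphism on `I`, then `δ = 0`, and either `F = 0`, or `R` is commutative,
`F(x)y = xF(y)` for all `x, y`, and the `(n-1)`-fold iterate of `F` is the identity. -/
theorem stmt_11 {R : Type*} [Ring R]
    (hprime : ∀ a b : R, (∀ r : R, a * r * b = 0) → a = 0 ∨ b = 0)
    (I : TwoSidedIdeal R) (hI : ∃ x : R, x ∈ I ∧ x ≠ 0)
    (n : ℕ) (hn : 2 ≤ n)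
    (F δ : R → R)
    (hδ : ∀ x y : R, δ (x * y) = δ x * y + x * δ y)
    (hF : ∀ x y : R, F (x * y) = F x * y + x * δ y)
    (hF' : ∀ x y : R, F (x * y) = δ x * y + x * F y)
    (hnanti : ∀ l : List R, l.length = n → (∀ x ∈ l, x ∈ I) →
      F l.prod = (l.reverse.map F).prod) :
    δ = 0 ∧ (F = 0 ∨ ((∀ a b : R, a * b = b * a) ∧
      (∀ x y : R, F x * y = x * F y) ∧ F^[n - 1] = id)) := by
  obtain ⟨m, rfl⟩ : ∃ m, n = m + 1 := ⟨n - 1, by omega⟩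
  have hm : m ≠ 0 := by omega
  have hlist : ∀ l : List R, l.length = m → (∀ x ∈ l, x ∈ I) →
      ∀ x ∈ I, F (l.prod * x) = F x * (l.reverse.map F).prod := fun l hl hlI x hx => by
    have hmem : ∀ z ∈ l ++ [x], z ∈ I := fun z hz => by
      rcases List.mem_append.1 hz with hz | hz
      · exact hlI z hz
      · rwa [List.mem_singleton.1 hz]
    simpa using hnanti (l ++ [x]) (by simp [hl]) hmem
  have hprod : ∀ w ∈ productsOfLength I m, ∃ P, ∀ x ∈ I, F (w * x) = F x * P := by
    rintro _ ⟨l, hl, hlI, rfl⟩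
    exact ⟨_, hlist l hl hlI⟩
  obtain ⟨w, hw, hw0⟩ : ∃ w ∈ productsOfLength I m, w ≠ 0 :=
    let ⟨_, huI, hu⟩ := hI
    exists_ne_zero_mem_productsOfLength hprime huI hu m
  have hmul := fun r => hprod _ (productsOfLength_mul_right hm hw r)
  have hδ0 : δ = 0 := by
    by_contra hne
    refine hne (derivation_eq_zero_of_forall_mul hprime hδ hw0 ?_)
    by_contra! hex
    obtain ⟨r, hr⟩ := hex
    have hδ1 : δ 0 = 0 := by simpa using hδ 0 0
    have hcomm := commute_of_derivation_eq_zero_or_central hprime hδ hr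
      (fun h => hr (h ▸ hδ1)) fun s => by
        obtain ⟨P, hP⟩ := hmul (r * s)
        rw [← mul_assoc] at hP
        exact derivation_eq_zero_or_central_of_antihom hprime hI hne hF hF' hP
    obtain ⟨P, hP⟩ := hmul r
    exact hr (derivation_eq_zero_of_antihom_of_commute hcomm hprime hI hne hF hP)
  refine ⟨hδ0, or_iff_not_imp_left.2 fun hF0 => ?_⟩
  have hFl : ∀ x, F x = F 1 * x := fun x => by simpa [hδ0] using hF 1 x
  have hFr : ∀ x, F x = x * F 1 := fun x => by simpa [hδ0] using hF' x 1
  have hc : ∀ y, F 1 * y = y * F 1 := fun y => (hFl y).symm.trans (hFr y)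
  have hc0 : F 1 ≠ 0 := fun h => hF0 (funext fun x => by simp [hFl x, h])
  have hcomm := commute_of_forall_mul_central hprime hw0 fun r =>
    (central_of_antihom_of_eq_mul hprime hI hc hc0 hFl (hmul r).choose_spec).2
  refine ⟨hcomm, fun x y => by rw [hFr x, hFl y, mul_assoc], funext fun x => ?_⟩
  obtain ⟨l, hl, hlI, rfl⟩ := hw
  have hlP := (central_of_antihom_of_eq_mul hprime hI hc hc0 hFl (hlist l hl hlI)).1
  rw [prod_map_reverse_of_commute hcomm hFl, hl, hcomm, ← sub_eq_zero] at hlP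
  have hpow : 1 - F 1 ^ m = 0 :=
    eq_zero_of_central_mul_eq_zero hprime (hcomm _) hw0 (by rwa [mul_sub, mul_one])
  rw [Nat.add_sub_cancel, iterate_eq_pow_mul hFl, ← sub_eq_zero.1 hpow, one_mul, id]
end

section
/- Let R be a prime ring, I a nonzero (two-sided) ideal of R, and n ≥ 2 a fixed integer. Suppose F : R → R is a two-sided multiplicative (generalized)-derivation associated with a multiplicative derivation δ of R such that F acts as an n-antihomomorphism on I. Then either δ = 0, or [w^{n−1}, y^{n−1}] ∈ Z(R) for all y, w ∈ I. -/
/-- In a prime ring, `a * x * b = 0` for all `x` in a nonzero ideal forces `a = 0` or `b = 0`. -/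
theorem eq_zero_or_eq_zero_of_forall_mem_mul_mul {R : Type*} [Ring R]
    (hprime : ∀ a b : R, (∀ r : R, a * r * b = 0) → a = 0 ∨ b = 0)
    (I : TwoSidedIdeal R) (hI : ∃ x : R, x ∈ I ∧ x ≠ 0) {a b : R}
    (h : ∀ x ∈ I, a * x * b = 0) : a = 0 ∨ b = 0 := by
  obtain ⟨c, hc, hc0⟩ := hI
  refine or_iff_not_imp_left.2 fun ha => (hprime c b fun s => ?_).resolve_left hc0
  refine (hprime a (c * s * b) fun r => ?_).resolve_left ha
  simpa only [mul_assoc] using h (r * (c * s)) (I.mul_mem_left _ _ (I.mul_mem_right _ _ hc))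

/-- If `F` is a two-sided generalized derivation associated with `δ` and
`F (u * x) = F x * W` for all `x` in an ideal, then `δ s * x * [W, r] + [u, s] * x * δ r = 0`. -/
theorem mul_commutator_add_commutator_mul_eq_zero {R : Type*} [Ring R]
    (I : TwoSidedIdeal R) {F δ : R → R}
    (hF : ∀ x y : R, F (x * y) = F x * y + x * δ y)
    (hF' : ∀ x y : R, F (x * y) = δ x * y + x * F y)
    {u W : R} (h : ∀ x ∈ I, F (u * x) = F x * W) {x : R} (hx : x ∈ I) (s r : R) :
    δ s * x * (W * r - r * W) + (u * s - s * u) * x * δ r = 0 := by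
  have key : ∀ z ∈ I, F z * (W * r - r * W) + u * z * δ r - z * δ r * W = 0 := by
    intro z hz
    have h₁ := h (z * r) (I.mul_mem_right _ _ hz)
    rw [← mul_assoc, hF (u * z), h z hz, hF z] at h₁
    rw [← sub_eq_zero.2 h₁]
    noncomm_ring
  have h₂ := key (s * x) (I.mul_mem_left _ _ hx)
  rw [hF'] at h₂
  calc _ = ((δ s * x + s * F x) * (W * r - r * W) + u * (s * x) * δ r - s * x * δ r * W)
        - s * (F x * (W * r - r * W) + u * x * δ r - x * δ r * W) := by noncomm_ring
    _ = 0 := by rw [h₂, key x hx, mul_zero, sub_zero]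

/-- Let `R` be a prime ring, `I` a nonzero two-sided ideal, `n ≥ 2`.  If `F` is a
two-sided multiplicative (generalized)-derivation associated with `δ` acting as an
`n`-antihomomorphism on `I`, then either `δ = 0` or `[w^(n-1), y^(n-1)] ∈ Z(R)` for
all `y, w ∈ I`. -/
theorem stmt_13 {R : Type*} [Ring R]
    (hprime : ∀ a b : R, (∀ r : R, a * r * b = 0) → a = 0 ∨ b = 0)
    (I : TwoSidedIdeal R) (hI : ∃ x : R, x ∈ I ∧ x ≠ 0)
    (n : ℕ) (hn : 2 ≤ n)
    (F δ : R → R)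
    (hδ : ∀ x y : R, δ (x * y) = δ x * y + x * δ y)
    (hF : ∀ x y : R, F (x * y) = F x * y + x * δ y)
    (hF' : ∀ x y : R, F (x * y) = δ x * y + x * F y)
    (hnanti : ∀ l : List R, l.length = n → (∀ x ∈ l, x ∈ I) →
      F l.prod = (l.reverse.map F).prod) :
    δ = 0 ∨ ∀ y ∈ I, ∀ w ∈ I,
      w ^ (n - 1) * y ^ (n - 1) - y ^ (n - 1) * w ^ (n - 1) ∈ Set.center R := by
  obtain ⟨m, rfl⟩ : ∃ m, n = m + 2 := ⟨n - 2, by omega⟩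
  simp only [show m + 2 - 1 = m + 1 from rfl]
  refine or_iff_not_imp_left.2 fun hδ0 => ?_
  obtain ⟨t, ht⟩ := Function.ne_iff.1 hδ0
  have hfac {a b : R} := eq_zero_or_eq_zero_of_forall_mem_mul_mul hprime I hI (a := a) (b := b)
  have hcomm : ∀ y ∈ I, ∀ x ∈ I, ∀ s r : R,
      δ s * x * (F y ^ (m + 1) * r - r * F y ^ (m + 1))
        + (y ^ (m + 1) * s - s * y ^ (m + 1)) * x * δ r = 0 := by
    intro y hy x hx s r
    refine mul_commutator_add_commutator_mul_eq_zero I hF hF' (fun z hz => ?_) hx s r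
    have h := hnanti (List.replicate (m + 1) y ++ [z]) (by simp) (by
      intro a ha
      rcases List.mem_append.1 ha with ha | ha
      · rwa [List.eq_of_mem_replicate ha]
      · rwa [List.mem_singleton.1 ha])
    simpa only [List.prod_append, List.prod_replicate, List.prod_singleton, List.reverse_append,
      List.reverse_replicate, List.reverse_singleton, List.map_append, List.map_replicate,
      List.map_singleton] using h
  have hcommute_of_δ : ∀ y ∈ I, ∀ s : R, δ s = 0 → Commute (y ^ (m + 1)) s := by
    intro y hy s hs
    refine sub_eq_zero.1 ((hfac fun x hx => ?_).resolve_right ht)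
    simpa [hs] using hcomm y hy x hx s t
  have hcentral_or : ∀ y ∈ I, (∀ s, Commute (y ^ (m + 1)) s) ∨ δ (y ^ (m + 1)) = 0 := by
    intro y hy
    refine or_iff_not_imp_right.2 fun hy0 s => ?_
    have hW : ∀ r, F y ^ (m + 1) * r - r * F y ^ (m + 1) = 0 := fun r =>
      (hfac fun x hx => by simpa using hcomm y hy x hx (y ^ (m + 1)) r).resolve_left hy0
    refine sub_eq_zero.1 ((hfac fun x hx => ?_).resolve_right ht)
    simpa [hW] using hcomm y hy x hx s t
  intro y hy w hw
  have hyw : Commute (w ^ (m + 1)) (y ^ (m + 1)) := by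
    rcases hcentral_or y hy with h | h
    · exact (h _).symm
    · exact hcommute_of_δ w hw _ h
  rw [hyw.eq, sub_self]
  exact Set.zero_mem_center
end
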